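/- Let X and ε be independent, centered normal random variables with variances σ_X² > 0 and σ_ε² > 0, and let Y = ρX + ε for some ρ > 0. Then on the Laplace scale | median(Y* | X* = x*) − a x* | = O(log x*) as x* → ∞, with a = ρ²σ_X²/(σ_ε² + ρ²σ_X²) ∈ (0,1). -/

import Mathlib

open Filter Topology MeasureTheory Set ProbabilityTheory
open scoped ENNReal NNReal

noncomputable section

/-- Generalized Pareto distribution function `H_γ(x) = 1 − (1+γx)₊^{−1/γ}`,
read as `1 − e^{−x}` when `γ = 0`. -/
def GPDcdf (γ x : ℝ) : ℝ :=
  if γ = 0 then 1 - Real.exp (-x) else 1 - max 0 (1 + γ * x) ^ (-(1 / γ))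

/-- The distribution function `F` has infinite upper endpoint. -/
def InfiniteUpperEndpoint (F : ℝ → ℝ) : Prop :=
  (∀ x, F x < 1) ∧ Tendsto F atTop (𝓝 1)

/-- First-order domain of attraction condition for a distribution function `F` with
positive scale function `σ` and shape `γ`: for every `x ≥ 0`,
`P(Y − u ≤ x σ(u) | Y > u) = (F(u + xσ(u)) − F(u))/(1 − F(u)) → H_γ(x)` as `u → ∞`. -/
def FirstOrderDoA (F σ : ℝ → ℝ) (γ : ℝ) : Prop :=
  (∀ u, 0 < σ u) ∧
    ∀ x : ℝ, 0 ≤ x →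
      Tendsto (fun u => (F (u + x * σ u) - F u) / (1 - F u)) atTop (𝓝 (GPDcdf γ x))

/-- The function `k_{γ,ρ}` describing second-order limits: for `ρ ≠ 0` it is
`(1/ρ)((x^{γ+ρ}−1)/(γ+ρ) − (x^γ−1)/γ)`, for `ρ = 0, γ ≠ 0` it is
`(1/γ)(x^γ log x − (x^γ−1)/γ)`, and for `ρ = γ = 0` it is `(log x)²/2`, where
`(x^c−1)/c` is read as `log x` when `c = 0`. -/
def kGammaRho (γ ρ x : ℝ) : ℝ :=
  if ρ ≠ 0 then
    (1 / ρ) * ((if γ + ρ = 0 then Real.log x else (x ^ (γ + ρ) - 1) / (γ + ρ)) -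
      (if γ = 0 then Real.log x else (x ^ γ - 1) / γ))
  else if γ ≠ 0 then (1 / γ) * (x ^ γ * Real.log x - (x ^ γ - 1) / γ)
  else Real.log x ^ 2 / 2

/-- The possible second-order limit functions
`h_{γ,ρ}(x) = −(H̄_γ(x))^{γ−1} k_{γ,ρ}(H̄_γ(x))`. -/
def hGammaRho (γ ρ x : ℝ) : ℝ :=
  -(1 - GPDcdf γ x) ^ (γ - 1) * kGammaRho γ ρ (1 - GPDcdf γ x)

/-- Second-order domain of attraction condition with auxiliary function `S`
(eventually of constant sign, tending to `0`) and second-order parameter `ρ`: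
`(F̄(u + xσ(u))/F̄(u) − H̄_γ(x)) / S(u) → h_{γ,ρ}(x)` for a non-zero limit function of
the form `c ⬝ h_{γ,ρ}`. -/
def SecondOrderDoA (F σ S : ℝ → ℝ) (γ ρ : ℝ) : Prop :=
  Tendsto S atTop (𝓝 0) ∧
    ((∀ᶠ u in atTop, 0 < S u) ∨ (∀ᶠ u in atTop, S u < 0)) ∧
    ∃ c : ℝ, c ≠ 0 ∧
      ∀ x : ℝ, 0 ≤ x →
        Tendsto (fun u => ((1 - F (u + x * σ u)) / (1 - F u) - (1 - GPDcdf γ x)) / S u)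
          atTop (𝓝 (c * hGammaRho γ ρ x))

/-- Quantile function (generalized inverse) of a distribution function. -/
def quantile (F : ℝ → ℝ) (τ : ℝ) : ℝ := sInf {x | τ ≤ F x}

/-- GPD tail approximation `F̃` of `F` above the threshold `u`:
`F̃(x) = 1 − (1 − F(u))(1 − H_γ((x−u)/σ(u)))` for `x > u`, and `F̃(x) = F(x)` for `x ≤ u`. -/
def tailApprox (F σ : ℝ → ℝ) (γ u x : ℝ) : ℝ :=
  if x ≤ u then F x else 1 - (1 - F u) * (1 - GPDcdf γ ((x - u) / σ u))

/-- GPD quantile approximation `Q̃` of `F` above the level `τ0`, with threshold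
`u = Q(τ0)`: `Q̃(τ) = u + (σ(u)/γ){((1−τ0)/(1−τ))^γ − 1}` for `τ > τ0` (read as
`u + σ(u) log((1−τ0)/(1−τ))` when `γ = 0`) and `Q̃(τ) = Q(τ)` for `τ ≤ τ0`. -/
def quantApprox (F σ : ℝ → ℝ) (γ τ0 τ : ℝ) : ℝ :=
  if τ ≤ τ0 then quantile F τ
  else if γ = 0 then quantile F τ0 + σ (quantile F τ0) * Real.log ((1 - τ0) / (1 - τ))
  else quantile F τ0 + σ (quantile F τ0) / γ * (((1 - τ0) / (1 - τ)) ^ γ - 1)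

/-- Standard Laplace distribution function. -/
def laplaceCDF (x : ℝ) : ℝ := if x < 0 then Real.exp x / 2 else 1 - Real.exp (-x) / 2

/-- Standard Laplace quantile function. -/
def laplaceQuantile (p : ℝ) : ℝ :=
  if p < 1 / 2 then Real.log (2 * p) else -Real.log (2 * (1 - p))

/-- The conditional median on the Laplace scale: if `m(x) = median(Y | X = x)` and
`X* = Q_L(F_X(X))`, `Y* = Q_L(F_Y(Y))`, then
`median(Y* | X* = x*) = Q_L(F_Y(m(Q_X(F_L(x*)))))`. -/
def medianLaplace (FX FY m : ℝ → ℝ) (xs : ℝ) : ℝ :=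
  laplaceQuantile (FY (m (quantile FX (laplaceCDF xs))))

/-- Assumption 1 (without the rate condition): there are `a ∈ [−1,1]`, `β ∈ [0,1)`,
`b ∈ ℝ` (with `β = 0` if `|a| = 1`, and `β, b ≠ 0` if `a = 0`) such that
`|median(Y* | X* = x*) − a x* − (x*)^β b| = r(x*)`. -/
def Assumption1Core (FX FY m : ℝ → ℝ) (a β b : ℝ) (r : ℝ → ℝ) : Prop :=
  a ∈ Set.Icc (-1 : ℝ) 1 ∧ β ∈ Set.Ico (0 : ℝ) 1 ∧ (|a| = 1 → β = 0) ∧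
    (a = 0 → β ≠ 0 ∧ b ≠ 0) ∧
    ∀ xs : ℝ, |medianLaplace FX FY m xs - a * xs - xs ^ β * b| = r xs

/-- Assumption 1, with the rate `r(x*) = o(1)` as `x* → ∞`. -/
def Assumption1 (FX FY m : ℝ → ℝ) (a β b : ℝ) (r : ℝ → ℝ) : Prop :=
  Assumption1Core FX FY m a β b r ∧ Tendsto r atTop (𝓝 0)

/-- The progression approximation at level `τ0`:
`m̃_{τ0}(x) = Q̃_Y(F_L(a x̃* + (x̃*)^β b))` where `x̃* = Q_L(F̃_X(x))`. -/
def progression (FX σX FY σY : ℝ → ℝ) (γX γY a β b τ0 x : ℝ) : ℝ :=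
  quantApprox FY σY γY τ0
    (laplaceCDF (a * laplaceQuantile (tailApprox FX σX γX (quantile FX τ0) x) +
      laplaceQuantile (tailApprox FX σX γX (quantile FX τ0) x) ^ β * b))

/-- Distribution function of a measure on `ℝ`. -/
def cdfOf (μ : Measure ℝ) (x : ℝ) : ℝ := (μ (Set.Iic x)).toReal

/-- A function is regularly varying with index `α` if `f(tx)/f(t) → x^α` for all `x > 1`. -/
def RegVary (f : ℝ → ℝ) (α : ℝ) : Prop :=
  ∀ x : ℝ, 1 < x → Tendsto (fun t => f (t * x) / f t) atTop (𝓝 (x ^ α))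

/-- A distribution `μ` is subexponential: for independent `X, X' ∼ μ`,
`P(X + X' > t) / (2 P(X > t)) → 1` as `t → ∞`. -/
def Subexponential (μ : Measure ℝ) : Prop :=
  Tendsto
    (fun t =>
      ((Measure.map (fun p : ℝ × ℝ => p.1 + p.2) (μ.prod μ)) (Set.Ioi t)).toReal /
        (2 * (μ (Set.Ioi t)).toReal)) atTop (𝓝 1)

/-- `c` is a median of the distribution `μ`. -/
def IsMedian (μ : Measure ℝ) (c : ℝ) : Prop :=
  (1 / 2 : ℝ≥0∞) ≤ μ (Set.Iic c) ∧ (1 / 2 : ℝ≥0∞) ≤ μ (Set.Ici c)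

/-- A distribution has a Weibull-like tail with parameters `(c, d, τ, η)`, `τ > 1`,
`c, d > 0`, `η ∈ ℝ`: it admits a density `g` with
`g(x) ∼ d x^{η+τ−1} exp(−c x^τ)` as `x → ∞`. -/
def WeibullLikeTail (μ : Measure ℝ) (c d τ η : ℝ) : Prop :=
  1 < τ ∧ 0 < c ∧ 0 < d ∧
    ∃ g : ℝ → ℝ, μ = MeasureTheory.volume.withDensity (fun x => ENNReal.ofReal (g x)) ∧
      Tendsto (fun x => g x / (d * x ^ (η + τ - 1) * Real.exp (-c * x ^ τ))) atTop (𝓝 1)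

lemma cdfOf_eq_cdf (μ : Measure ℝ) [IsProbabilityMeasure μ] : cdfOf μ = cdf μ := by
  ext x
  rw [cdf_eq_real]
  rfl

lemma continuous_cdfOf (μ : Measure ℝ) [IsProbabilityMeasure μ] (hμ : ∀ x, μ {x} = 0) :
    Continuous (cdfOf μ) := by
  rw [cdfOf_eq_cdf, continuous_iff_continuousAt]
  intro x
  rw [continuousAt_iff_continuous_left'_right']
  refine ⟨?_, ((cdf μ).right_continuous x).mono Ioi_subset_Ici_self⟩
  rw [(monotone_cdf μ).continuousWithinAt_Iio_iff_leftLim_eq]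
  have h := (cdf μ).measure_singleton x
  rw [measure_cdf, hμ x, eq_comm, ENNReal.ofReal_eq_zero, sub_nonpos] at h
  exact le_antisymm ((monotone_cdf μ).leftLim_le le_rfl) h

/-- A continuous distribution function inverts its quantile function on `(0, 1)`. -/
lemma apply_quantile {F : ℝ → ℝ} (hc : Continuous F) (hm : Monotone F)
    (hbot : Tendsto F atBot (𝓝 0)) (htop : Tendsto F atTop (𝓝 1)) {p : ℝ}
    (hp : p ∈ Ioo (0 : ℝ) 1) : F (quantile F p) = p := by
  obtain ⟨l, hl⟩ := (hbot.eventually (gt_mem_nhds hp.1)).exists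
  obtain ⟨u, hu⟩ := (htop.eventually (lt_mem_nhds hp.2)).exists
  obtain ⟨q, hq⟩ := mem_range_of_exists_le_of_exists_ge hc ⟨l, hl.le⟩ ⟨u, hu.le⟩
  have hbdd : BddBelow {x | p ≤ F x} :=
    ⟨l, fun x hx => (hm.reflect_lt (hl.trans_le hx)).le⟩
  have hmem : quantile F p ∈ {x | p ≤ F x} :=
    (isClosed_le continuous_const hc).csInf_mem ⟨q, hq.ge⟩ hbdd
  exact le_antisymm ((hm (csInf_le hbdd hq.ge)).trans hq.le) hmem

lemma map_mul_add_gaussianReal (vX vε : ℝ≥0) (ρ : ℝ) :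
    Measure.map (fun p : ℝ × ℝ => ρ * p.1 + p.2) ((gaussianReal 0 vX).prod (gaussianReal 0 vε)) =
      gaussianReal 0 (.mk (ρ ^ 2) (sq_nonneg ρ) * vX + vε) := by
  have h : gaussianReal 0 (.mk (ρ ^ 2) (sq_nonneg ρ) * vX + vε) =
      (gaussianReal (ρ * 0) (.mk (ρ ^ 2) (sq_nonneg ρ) * vX)).conv (gaussianReal 0 vε) := by
    rw [gaussianReal_conv_gaussianReal]
    simp
  rw [h, ← gaussianReal_map_const_mul, Measure.conv]
  conv_rhs => rw [← Measure.map_id (μ := gaussianReal 0 vε)]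
  rw [Measure.map_prod_map _ _ (by fun_prop) (by fun_prop), Measure.map_map (by fun_prop)
    (by fun_prop)]
  rfl

lemma one_sub_cdfOf (μ : Measure ℝ) [IsProbabilityMeasure μ] (y : ℝ) :
    1 - cdfOf μ y = μ.real (Ioi y) := by
  rw [← compl_Iic, probReal_compl_eq_one_sub measurableSet_Iic]
  rfl

lemma gaussianReal_Ioi_le {v : ℝ≥0} (hv : 0 < v) {y : ℝ} (hy : 0 ≤ y) :
    (gaussianReal 0 v).real (Ioi y) ≤ Real.exp (-(y ^ 2 / (2 * v))) := by
  have hv' : (0 : ℝ) < v := hv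
  have h := measure_ge_le_exp_mul_mgf (μ := gaussianReal 0 v) (X := id) y
    (t := y / v) (by positivity) (integrable_exp_mul_gaussianReal _)
  rw [mgf_id_gaussianReal, ← Real.exp_add] at h
  have hsub : Ioi y ⊆ {x : ℝ | y ≤ id x} := Ioi_subset_Ici_self
  refine (measureReal_mono hsub).trans (h.trans_eq ?_)
  congr 1
  field_simp
  ring

lemma le_gaussianReal_Ioi {v : ℝ≥0} (hv : 0 < v) {y : ℝ} (hy : 1 ≤ y) :
    y⁻¹ * ((√(2 * Real.pi * v))⁻¹ * Real.exp (-(y ^ 2 + 3) / (2 * v))) ≤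
      (gaussianReal 0 v).real (Ioi y) := by
  have hv' : (0 : ℝ) < v := hv
  have hy0 : 0 < y := by linarith
  have hsub : Ioc y (y + y⁻¹) ⊆ Ioi y := Ioc_subset_Ioi_self
  refine le_trans ?_ (measureReal_mono hsub)
  rw [measureReal_def, gaussianReal_apply_eq_integral _ hv.ne', ENNReal.toReal_ofReal
    (integral_nonneg fun x => gaussianPDFReal_nonneg _ _ _)]
  have hvol : volume.real (Ioc y (y + y⁻¹)) = y⁻¹ := by
    rw [Real.volume_real_Ioc_of_le (by simp [hy0.le])]
    ring
  have := setIntegral_mono_on (μ := volume) (s := Ioc y (y + y⁻¹))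
    (f := fun _ => (√(2 * Real.pi * v))⁻¹ * Real.exp (-(y ^ 2 + 3) / (2 * v)))
    (g := gaussianPDFReal 0 v) (integrableOn_const (by simp)) (integrable_gaussianPDFReal _ _).integrableOn
    measurableSet_Ioc (fun x hx => by
      rw [gaussianPDFReal_def]
      have hx1 : x ^ 2 ≤ y ^ 2 + 3 := by
        have hinv : y⁻¹ ≤ 1 := inv_le_one_of_one_le₀ hy
        have h1 : x ^ 2 ≤ (y + y⁻¹) ^ 2 := pow_le_pow_left₀ (by linarith [hx.1]) hx.2 2
        have h2 : y * y⁻¹ = 1 := mul_inv_cancel₀ hy0.ne'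
        have h3 : 0 < y⁻¹ := by positivity
        nlinarith
      simp only [sub_zero]
      gcongr)
  rwa [setIntegral_const, hvol, smul_eq_mul] at this

/-- On the exponential scale the Gaussian tail is quadratic up to a logarithmic error. -/
lemma exists_abs_neg_log_gaussianReal_Ioi_sub_le {v : ℝ≥0} (hv : 0 < v) :
    ∃ A : ℝ, 0 ≤ A ∧ ∀ y : ℝ, 1 ≤ y →
      |-Real.log (2 * (gaussianReal 0 v).real (Ioi y)) - y ^ 2 / (2 * v)| ≤ A + Real.log y := by
  have hv' : (0 : ℝ) < v := hv
  set c : ℝ := (√(2 * Real.pi * v))⁻¹ with hc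
  have hc0 : 0 < c := by positivity
  refine ⟨Real.log 2 + |Real.log c| + 3 / (2 * v), by positivity, fun y hy => ?_⟩
  have hy0 : 0 < y := by linarith
  have hlow := le_gaussianReal_Ioi hv hy
  have hpos : 0 < (gaussianReal 0 v).real (Ioi y) := lt_of_lt_of_le (by positivity) hlow
  have hup := Real.log_le_log hpos (gaussianReal_Ioi_le hv hy0.le)
  have hlow' := Real.log_le_log (by positivity) hlow
  rw [Real.log_exp] at hup
  rw [← hc, Real.log_mul (by positivity) (by positivity), Real.log_inv,
    Real.log_mul hc0.ne' (by positivity), Real.log_exp, neg_div, add_div] at hlow'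
  rw [Real.log_mul two_ne_zero hpos.ne']
  have hlog2 : 0 < Real.log 2 := Real.log_pos one_lt_two
  have hlogy : 0 ≤ Real.log y := Real.log_nonneg hy
  have hfrac : (0 : ℝ) < 3 / (2 * v) := by positivity
  have := neg_abs_le (Real.log c)
  have := abs_nonneg (Real.log c)
  rw [abs_le]
  constructor <;> linarith

lemma gaussianReal_real_Ioi_pos {v : ℝ≥0} (hv : 0 < v) (y : ℝ) :
    0 < (gaussianReal 0 v).real (Ioi y) := by
  have hv' : (0 : ℝ) < v := hv
  have hy : 1 ≤ max y 1 := le_max_right y 1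
  refine lt_of_lt_of_le ?_ (measureReal_mono (Ioi_subset_Ioi (le_max_left y 1)))
  exact lt_of_lt_of_le (by positivity) (le_gaussianReal_Ioi hv hy)

lemma one_sub_cdfOf_quantile_gaussianReal {v : ℝ≥0} (hv : 0 < v) {x : ℝ} (hx : 0 ≤ x) :
    1 - cdfOf (gaussianReal 0 v) (quantile (cdfOf (gaussianReal 0 v)) (laplaceCDF x)) =
      Real.exp (-x) / 2 := by
  have hp : laplaceCDF x = 1 - Real.exp (-x) / 2 := by simp [laplaceCDF, hx.not_gt]
  have hexp : Real.exp (-x) ≤ 1 := Real.exp_le_one_iff.mpr (by linarith)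
  have hcont : Continuous (cdfOf (gaussianReal 0 v)) := by
    have := nullSingletonClass_gaussianReal (μ := 0) hv.ne'
    exact continuous_cdfOf _ fun x => measure_singleton x
  have h := apply_quantile (p := laplaceCDF x) hcont (by rw [cdfOf_eq_cdf]; exact monotone_cdf _)
    (by rw [cdfOf_eq_cdf]; exact tendsto_cdf_atBot _)
    (by rw [cdfOf_eq_cdf]; exact tendsto_cdf_atTop _)
    (by rw [hp]; constructor <;> linarith [Real.exp_pos (-x)])
  rw [h, hp]
  ring

lemma tendsto_quantile_laplaceCDF_gaussianReal {v : ℝ≥0} (hv : 0 < v) :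
    Tendsto (fun x => quantile (cdfOf (gaussianReal 0 v)) (laplaceCDF x)) atTop atTop := by
  refine tendsto_atTop.mpr fun M => ?_
  have hlim : Tendsto (fun x : ℝ => Real.exp (-x) / 2) atTop (𝓝 0) := by
    simpa using (Real.tendsto_exp_neg_atTop_nhds_zero).div_const 2
  filter_upwards [hlim.eventually (gt_mem_nhds (gaussianReal_real_Ioi_pos hv M)),
    eventually_ge_atTop 0] with x hx hx0
  rw [← one_sub_cdfOf_quantile_gaussianReal hv hx0, ← one_sub_cdfOf, cdfOf_eq_cdf] at hx
  rw [cdfOf_eq_cdf]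
  exact ((monotone_cdf _).reflect_lt (sub_lt_sub_iff_left 1 |>.mp hx)).le

/-- Example, Gaussian case: if `X ∼ N(0, v_X)` and `ε ∼ N(0, v_ε)` are
independent and `Y = ρX + ε` with `ρ > 0`, then on the Laplace scale
`|median(Y* | X* = x*) − a x*| = O(log x*)` as `x* → ∞`, with
`a = ρ² v_X / (v_ε + ρ² v_X) ∈ (0,1)`. -/
theorem gaussian_laplace_median
    (vX vε : ℝ≥0) (hvX : 0 < vX) (hvε : 0 < vε) (ρ : ℝ) (hρ : 0 < ρ) :
    ∃ C > 0, ∀ᶠ xs in atTop,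
      |medianLaplace (cdfOf (gaussianReal 0 vX))
          (cdfOf (Measure.map (fun p : ℝ × ℝ => ρ * p.1 + p.2)
            ((gaussianReal 0 vX).prod (gaussianReal 0 vε))))
          (fun x => ρ * x) xs -
        ρ ^ 2 * (vX : ℝ) / ((vε : ℝ) + ρ ^ 2 * (vX : ℝ)) * xs| ≤ C * Real.log xs := by
  rw [map_mul_add_gaussianReal]
  set V : ℝ≥0 := .mk (ρ ^ 2) (sq_nonneg ρ) * vX + vε with hV
  have hV0 : 0 < V := add_pos_of_nonneg_of_pos zero_le hvε
  have hVr : (V : ℝ) = vε + ρ ^ 2 * vX := by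
    rw [hV, NNReal.coe_add, NNReal.coe_mul, add_comm]
    rfl
  have hV0' : (0 : ℝ) < V := hV0
  have hvX' : (0 : ℝ) < vX := hvX
  rw [← hVr]
  set a : ℝ := ρ ^ 2 * vX / V with ha
  have ha0 : 0 < a := by positivity
  obtain ⟨A, hA, hAX⟩ := exists_abs_neg_log_gaussianReal_Ioi_sub_le hvX
  obtain ⟨B, hB, hBY⟩ := exists_abs_neg_log_gaussianReal_Ioi_sub_le hV0
  refine ⟨B + |Real.log ρ| + a * A + (1 + a), by positivity, ?_⟩
  set Q : ℝ → ℝ := fun x => quantile (cdfOf (gaussianReal 0 vX)) (laplaceCDF x) with hQdef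
  have hQ : Tendsto Q atTop atTop := tendsto_quantile_laplaceCDF_gaussianReal hvX
  have hρQ : Tendsto (fun x => ρ * Q x) atTop atTop := hQ.const_mul_atTop hρ
  have hFY : Tendsto (cdfOf (gaussianReal 0 V)) atTop (𝓝 1) := by
    rw [cdfOf_eq_cdf]
    exact tendsto_cdf_atTop _
  filter_upwards [hQ.eventually_ge_atTop 1, hρQ.eventually_ge_atTop 1,
    hQ.eventually_ge_atTop (2 * vX * (2 + A)), eventually_ge_atTop (Real.exp 1),
    (hFY.comp hρQ).eventually (lt_mem_nhds (by norm_num : (1 / 2 : ℝ) < 1))]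
    with x hq1 hρq1 hqlarge hxe hhalf
  have hx0 : 0 < x := (Real.exp_pos 1).trans_le hxe
  have hlogx : 1 ≤ Real.log x := (Real.le_log_iff_exp_le hx0).mpr hxe
  set q := Q x with hq
  have hq0 : 0 < q := by linarith
  have hX := hAX q hq1
  have hY := hBY (ρ * q) hρq1
  have htail : 2 * (gaussianReal 0 vX).real (Ioi q) = Real.exp (-x) := by
    rw [← one_sub_cdfOf, hq, hQdef, one_sub_cdfOf_quantile_gaussianReal hvX hx0.le]
    ring
  rw [htail, Real.log_exp, neg_neg] at hX
  have hmed : medianLaplace (cdfOf (gaussianReal 0 vX)) (cdfOf (gaussianReal 0 V))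
      (fun x => ρ * x) x = -Real.log (2 * (gaussianReal 0 V).real (Ioi (ρ * q))) := by
    have hhalf' : ¬ cdfOf (gaussianReal 0 V) (ρ * q) < 1 / 2 := not_lt.mpr hhalf.le
    rw [← one_sub_cdfOf]
    exact if_neg hhalf'
  rw [hmed]
  have hlogq_le : Real.log q ≤ q := (Real.log_le_sub_one_of_pos hq0).trans (by linarith)
  have hqx : q ≤ x := by
    have h1 : (2 + A) * q ≤ q ^ 2 / (2 * vX) := by
      rw [le_div_iff₀ (by positivity)]
      nlinarith
    have h2 := (abs_le.mp hX).1
    nlinarith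
  have hlogq : Real.log q ≤ Real.log x := Real.log_le_log hq0 hqx
  have hsq : (ρ * q) ^ 2 / (2 * V) = a * (q ^ 2 / (2 * vX)) := by
    rw [ha]
    field_simp
  rw [hsq, Real.log_mul hρ.ne' hq0.ne'] at hY
  have hY' := abs_le.mp hY
  have hX1 := mul_le_mul_of_nonneg_left (abs_le.mp hX).1 ha0.le
  have hX2 := mul_le_mul_of_nonneg_left (abs_le.mp hX).2 ha0.le
  have hρlog := le_abs_self (Real.log ρ)
  have hconst : B + |Real.log ρ| + a * A ≤ (B + |Real.log ρ| + a * A) * Real.log x :=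
    le_mul_of_one_le_right (by positivity) hlogx
  have halog : a * Real.log q ≤ a * Real.log x := mul_le_mul_of_nonneg_left hlogq ha0.le
  rw [abs_le]
  constructor <;> linarith [hY'.1, hY'.2]
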